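/- Let X and Y be finite R-modules with X ∼ Y, and let P → X and Q → Y be surjective R-homomorphisms, where P and Q are finite R-modules of projective dimension at most 1 over R. Then ker(P → X) ∼ ker(Q → Y). (Well-definedness of the first syzygy operator ω¹ on equivalence classes of finite R-modules, for possibly nonabelian Γ₀.) -/

import Mathlib

/-- `𝒪` is one of the rings `ℤ`, `ℤ[1/2]`, or `ℤ_p` for some prime `p`. -/
def IsAllowedBase (𝒪 : Type) [CommRing 𝒪] : Prop :=
  Nonempty (𝒪 ≃+* ℤ) ∨ Nonempty (𝒪 ≃+* Localization.Away (2 : ℤ)) ∨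
    ∃ (p : ℕ) (hp : p.Prime), Nonempty (𝒪 ≃+* @PadicInt p ⟨hp⟩)

/-- Projective dimension at most one. -/
def PdLeOne (R : Type) [Ring R] (X : Type) [AddCommGroup X] [Module R X] : Prop :=
  ∃ (P : Type) (_ : AddCommGroup P) (_ : Module R P) (f : P →ₗ[R] X),
    Function.Surjective f ∧ Module.Projective R P ∧
      Module.Projective R (LinearMap.ker f)

/-- Equivalence of finite `R`-modules. -/
def ModEquiv (R : Type) [Ring R]
    (X : Type) [AddCommGroup X] [Module R X]
    (Y : Type) [AddCommGroup Y] [Module R Y] : Prop :=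
  ∃ (M : Type) (_ : AddCommGroup M) (_ : Module R M)
    (N : Type) (_ : AddCommGroup N) (_ : Module R N),
      Finite M ∧ Finite N ∧ Nonempty (M ≃ₗ[R] N) ∧
      ∃ (M' M'' : Submodule R M) (N' N'' : Submodule R N),
        M' ≤ M'' ∧ N' ≤ N'' ∧
        PdLeOne R M' ∧ PdLeOne R N' ∧
        PdLeOne R (M ⧸ M'') ∧ PdLeOne R (N ⧸ N'') ∧
        Nonempty ((M'' ⧸ (M'.comap M''.subtype)) ≃ₗ[R] X) ∧
        Nonempty ((N'' ⧸ (N'.comap N''.subtype)) ≃ₗ[R] Y)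

open CategoryTheory in
theorem pdLeOne_iff_hasProjectiveDimensionLT {R : Type} [Ring R] {X : Type} [AddCommGroup X]
    [Module R X] : PdLeOne R X ↔ HasProjectiveDimensionLT (ModuleCat.of R X) 2 := by
  constructor
  · rintro ⟨P, _, _, f, hf, hP, hK⟩
    have hs := LinearMap.shortExact_shortComplexKer hf
    have : Projective (ModuleCat.of R P) := inferInstance
    have : Projective (ModuleCat.of R (LinearMap.ker f)) := inferInstance
    exact (hs.hasProjectiveDimensionLT_X₃_iff 0 ‹_›).2
      (inferInstanceAs (HasProjectiveDimensionLT (ModuleCat.of R (LinearMap.ker f)) 1))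
  · intro h
    have hf : Function.Surjective (Finsupp.linearCombination R (id : X → X)) :=
      Finsupp.linearCombination_id_surjective R X
    refine ⟨X →₀ R, inferInstance, inferInstance, _, hf, inferInstance, ?_⟩
    have hs := LinearMap.shortExact_shortComplexKer hf
    have : Projective (ModuleCat.of R (X →₀ R)) := inferInstance
    rw [IsProjective.iff_projective, projective_iff_hasProjectiveDimensionLT_one]
    exact (hs.hasProjectiveDimensionLT_X₃_iff 0 ‹_›).1 h

section ShortExact

variable {R : Type} [Ring R] {A B C : Type} [AddCommGroup A] [Module R A] [AddCommGroup B]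
  [Module R B] [AddCommGroup C] [Module R C]

theorem PdLeOne.of_exact {i : A →ₗ[R] B} {q : B →ₗ[R] C} (hi : Function.Injective i)
    (hq : Function.Surjective q) (he : Function.Exact i q) (hA : PdLeOne R A)
    (hC : PdLeOne R C) : PdLeOne R B := by
  rw [pdLeOne_iff_hasProjectiveDimensionLT] at *
  exact (ModuleCat.shortComplex_shortExact
    (ModuleCat.shortComplexOfCompEqZero i q he.linearMap_comp_eq_zero)
    he hi hq).hasProjectiveDimensionLT_X₂ 2 hA hC

theorem PdLeOne.ker {q : B →ₗ[R] C} (hq : Function.Surjective q) (hB : PdLeOne R B)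
    (hC : PdLeOne R C) : PdLeOne R (LinearMap.ker q) := by
  rw [pdLeOne_iff_hasProjectiveDimensionLT] at *
  have := CategoryTheory.hasProjectiveDimensionLT_of_ge (ModuleCat.of R C) 2 3 (by norm_num)
  exact (LinearMap.shortExact_shortComplexKer hq).hasProjectiveDimensionLT_X₁ 2 hB this

theorem PdLeOne.of_equiv (e : A ≃ₗ[R] B) (hA : PdLeOne R A) : PdLeOne R B := by
  obtain ⟨P, _, _, f, hf, hP, hK⟩ := hA
  refine ⟨P, _, _, e.toLinearMap ∘ₗ f, e.surjective.comp hf, hP, ?_⟩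
  rwa [LinearEquiv.ker_comp]

theorem PdLeOne.of_subsingleton [Subsingleton A] : PdLeOne R A :=
  ⟨A, _, _, LinearMap.id, Function.surjective_id, inferInstance, inferInstance⟩

/-- `A` embeds into `B` with cokernel of projective dimension at most one. -/
def EmbedsWithPdLeOneCokernel (R : Type) [Ring R] (A B : Type) [AddCommGroup A] [Module R A]
    [AddCommGroup B] [Module R B] : Prop :=
  ∃ i : A →ₗ[R] B, Function.Injective i ∧ PdLeOne R (B ⧸ LinearMap.range i)

theorem EmbedsWithPdLeOneCokernel.of_exact {i : A →ₗ[R] B} {q : B →ₗ[R] C}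
    (hi : Function.Injective i) (hq : Function.Surjective q) (he : Function.Exact i q)
    (hC : PdLeOne R C) : EmbedsWithPdLeOneCokernel R A B :=
  ⟨i, hi, hC.of_equiv ((Submodule.quotEquivOfEq _ _ he.linearMap_ker_eq.symm).trans
    (q.quotKerEquivOfSurjective hq)).symm⟩

theorem EmbedsWithPdLeOneCokernel.trans (h : EmbedsWithPdLeOneCokernel R A B)
    (h' : EmbedsWithPdLeOneCokernel R B C) : EmbedsWithPdLeOneCokernel R A C := by
  obtain ⟨i, hi, hB⟩ := h
  obtain ⟨j, hj, hC⟩ := h'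
  have hle : LinearMap.range i ≤ (LinearMap.range (j ∘ₗ i)).comap j := by
    rintro _ ⟨a, rfl⟩
    exact ⟨a, rfl⟩
  refine ⟨j ∘ₗ i, hj.comp hi, PdLeOne.of_exact (i := Submodule.mapQ _ _ j hle)
    (q := Submodule.factor (LinearMap.range_comp_le_range i j)) ?_ ?_ ?_ hB hC⟩
  · rw [← LinearMap.ker_eq_bot, LinearMap.ker_eq_bot']
    intro x hx
    obtain ⟨b, rfl⟩ := Submodule.mkQ_surjective _ x
    obtain ⟨a, ha⟩ := (Submodule.Quotient.mk_eq_zero _).1 hx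
    exact (Submodule.Quotient.mk_eq_zero _).2 ⟨a, hj ha⟩
  · exact Submodule.factor_surjective _
  · intro x
    obtain ⟨c, rfl⟩ := Submodule.mkQ_surjective _ x
    constructor
    · intro hx
      obtain ⟨b, rfl⟩ := (Submodule.Quotient.mk_eq_zero _).1 hx
      exact ⟨Submodule.mkQ _ b, rfl⟩
    · rintro ⟨y, hy⟩
      obtain ⟨b, rfl⟩ := Submodule.mkQ_surjective _ y
      rw [← hy]
      exact (Submodule.Quotient.mk_eq_zero _).2 ⟨b, rfl⟩

/-- Two embeddings of `A` can be completed to a commutative square by the pushout. -/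
theorem EmbedsWithPdLeOneCokernel.amalgamate [Finite B] [Finite C]
    (hB : EmbedsWithPdLeOneCokernel R A B) (hC : EmbedsWithPdLeOneCokernel R A C) :
    ∃ (D : Type) (_ : AddCommGroup D) (_ : Module R D), Finite D ∧
      EmbedsWithPdLeOneCokernel R B D ∧ EmbedsWithPdLeOneCokernel R C D := by
  obtain ⟨i, hi, hB⟩ := hB
  obtain ⟨j, hj, hC⟩ := hC
  let S := LinearMap.range (i.prod j)
  refine ⟨(B × C) ⧸ S, inferInstance, inferInstance,
    Finite.of_surjective S.mkQ S.mkQ_surjective, ?_, ?_⟩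
  · refine .of_exact (i := S.mkQ ∘ₗ LinearMap.inl R B C)
      (q := S.liftQ ((LinearMap.range j).mkQ ∘ₗ LinearMap.snd R B C) ?_) ?_ ?_ ?_ hC
    · rintro _ ⟨a, rfl⟩
      exact (Submodule.Quotient.mk_eq_zero _).2 ⟨a, rfl⟩
    · rw [← LinearMap.ker_eq_bot, LinearMap.ker_eq_bot']
      intro b hb
      obtain ⟨a, ha⟩ := (Submodule.Quotient.mk_eq_zero _).1 hb
      obtain ⟨h1, h2⟩ := Prod.ext_iff.1 ha
      obtain rfl : a = 0 := hj (by simpa using h2)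
      simpa using h1.symm
    · intro x
      obtain ⟨c, rfl⟩ := Submodule.mkQ_surjective _ x
      exact ⟨S.mkQ (0, c), rfl⟩
    · intro x
      obtain ⟨⟨b, c⟩, rfl⟩ := Submodule.mkQ_surjective _ x
      constructor
      · intro hx
        obtain ⟨a, rfl⟩ := (Submodule.Quotient.mk_eq_zero _).1 hx
        refine ⟨b - i a, (Submodule.Quotient.eq S).2 ⟨-a, ?_⟩⟩
        simp
      · rintro ⟨y, hy⟩
        rw [← hy]
        simp
  · refine .of_exact (i := S.mkQ ∘ₗ LinearMap.inr R B C)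
      (q := S.liftQ ((LinearMap.range i).mkQ ∘ₗ LinearMap.fst R B C) ?_) ?_ ?_ ?_ hB
    · rintro _ ⟨a, rfl⟩
      exact (Submodule.Quotient.mk_eq_zero _).2 ⟨a, rfl⟩
    · rw [← LinearMap.ker_eq_bot, LinearMap.ker_eq_bot']
      intro c hc
      obtain ⟨a, ha⟩ := (Submodule.Quotient.mk_eq_zero _).1 hc
      obtain ⟨h1, h2⟩ := Prod.ext_iff.1 ha
      obtain rfl : a = 0 := hi (by simpa using h1)
      simpa using h2.symm
    · intro x
      obtain ⟨b, rfl⟩ := Submodule.mkQ_surjective _ x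
      exact ⟨S.mkQ (b, 0), rfl⟩
    · intro x
      obtain ⟨⟨b, c⟩, rfl⟩ := Submodule.mkQ_surjective _ x
      constructor
      · intro hx
        obtain ⟨a, rfl⟩ := (Submodule.Quotient.mk_eq_zero _).1 hx
        refine ⟨c - j a, (Submodule.Quotient.eq S).2 ⟨-a, ?_⟩⟩
        simp
      · rintro ⟨y, hy⟩
        rw [← hy]
        simp

theorem ModEquiv.of_embeds [Finite C] (hA : EmbedsWithPdLeOneCokernel R A C)
    (hB : EmbedsWithPdLeOneCokernel R B C) : ModEquiv R A B := by
  obtain ⟨i, hi, hA⟩ := hA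
  obtain ⟨j, hj, hB⟩ := hB
  have key {D : Type} [AddCommGroup D] [Module R D] (k : D →ₗ[R] C)
      (hk : Function.Injective k) :
      Nonempty ((LinearMap.range k ⧸ ((⊥ : Submodule R C).comap (LinearMap.range k).subtype))
        ≃ₗ[R] D) :=
    ⟨(Submodule.quotEquivOfEqBot _ (by
      rw [Submodule.comap_bot, Submodule.ker_subtype])).trans (LinearEquiv.ofInjective k hk).symm⟩
  exact ⟨C, _, _, C, _, _, ‹_›, ‹_›, ⟨.refl R C⟩, ⊥, LinearMap.range i, ⊥, LinearMap.range j,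
    bot_le, bot_le, .of_subsingleton, .of_subsingleton, hA, hB, key i hi, key j hj⟩

/-- The kernels of two covers of the same module embed into the fibre product of the covers. -/
theorem EmbedsWithPdLeOneCokernel.fibreProduct [Finite A] [Finite B] {f : A →ₗ[R] C}
    {g : B →ₗ[R] C} (hf : Function.Surjective f) (hg : Function.Surjective g)
    (hA : PdLeOne R A) (hB : PdLeOne R B) :
    ∃ (D : Type) (_ : AddCommGroup D) (_ : Module R D), Finite D ∧
      EmbedsWithPdLeOneCokernel R (LinearMap.ker f) D ∧
      EmbedsWithPdLeOneCokernel R (LinearMap.ker g) D := by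
  let S := LinearMap.ker (f ∘ₗ LinearMap.fst R A B - g ∘ₗ LinearMap.snd R A B)
  have hS (x : A × B) : x ∈ S ↔ f x.1 = g x.2 := by simp [S, sub_eq_zero]
  refine ⟨S, inferInstance, inferInstance, inferInstance, ?_, ?_⟩
  · refine .of_exact (q := LinearMap.snd R A B ∘ₗ S.subtype)
      (i := (LinearMap.inl R A B ∘ₗ (LinearMap.ker f).subtype).codRestrict S
        fun x ↦ (hS _).2 (by simp)) ?_ ?_ ?_ hB
    · intro x y h
      simpa using congrArg (fun s : S ↦ s.1.1) h
    · intro b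
      obtain ⟨a, ha⟩ := hf (g b)
      exact ⟨⟨(a, b), (hS _).2 ha⟩, rfl⟩
    · rintro ⟨⟨a, b⟩, h⟩
      constructor
      · rintro (rfl : b = 0)
        exact ⟨⟨a, by simpa using (hS _).1 h⟩, rfl⟩
      · rintro ⟨y, hy⟩
        rw [← hy]
        simp
  · refine .of_exact (q := LinearMap.fst R A B ∘ₗ S.subtype)
      (i := (LinearMap.inr R A B ∘ₗ (LinearMap.ker g).subtype).codRestrict S
        fun x ↦ (hS _).2 (by simp)) ?_ ?_ ?_ hA
    · intro x y h
      simpa using congrArg (fun s : S ↦ s.1.2) h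
    · intro a
      obtain ⟨b, hb⟩ := hg (f a)
      exact ⟨⟨(a, b), (hS _).2 hb.symm⟩, rfl⟩
    · rintro ⟨⟨a, b⟩, h⟩
      constructor
      · rintro (rfl : a = 0)
        exact ⟨⟨b, by simpa using ((hS _).1 h).symm⟩, rfl⟩
      · rintro ⟨y, hy⟩
        rw [← hy]
        simp

end ShortExact

/-- If `X` is a subquotient of `M` as in the definition of `ModEquiv`, then the kernel of a cover
of `M` and the kernel of a cover of `X` embed into a common finite module. -/
theorem EmbedsWithPdLeOneCokernel.of_subquotient {R : Type} [Ring R] {M X F P : Type}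
    [AddCommGroup M] [Module R M] [AddCommGroup X] [Module R X] [AddCommGroup F] [Module R F]
    [AddCommGroup P] [Module R P] [Finite F] [Finite P] {M' M'' : Submodule R M}
    (hle : M' ≤ M'') (hM' : PdLeOne R M') (hM'' : PdLeOne R (M ⧸ M''))
    (e : (M'' ⧸ M'.comap M''.subtype) ≃ₗ[R] X) {π : F →ₗ[R] M} (hπ : Function.Surjective π)
    (hF : PdLeOne R F) {f : P →ₗ[R] X} (hf : Function.Surjective f) (hP : PdLeOne R P) :
    ∃ (D : Type) (_ : AddCommGroup D) (_ : Module R D), Finite D ∧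
      EmbedsWithPdLeOneCokernel R (LinearMap.ker f) D ∧
      EmbedsWithPdLeOneCokernel R (LinearMap.ker π) D := by
  let F'' := LinearMap.ker (M''.mkQ ∘ₗ π)
  have hF'' : PdLeOne R F'' := hF.ker (M''.mkQ_surjective.comp hπ) hM''
  have mem_F'' (x : F) : x ∈ F'' ↔ π x ∈ M'' := by simp [F'']
  let ρ : F'' →ₗ[R] M'' := (π ∘ₗ F''.subtype).codRestrict M'' fun x ↦ (mem_F'' x).1 x.2
  have hρ : Function.Surjective ρ := fun ⟨m, hm⟩ ↦ by
    obtain ⟨x, rfl⟩ := hπ m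
    exact ⟨⟨x, (mem_F'' x).2 hm⟩, rfl⟩
  let h : F'' →ₗ[R] X := e.toLinearMap ∘ₗ (M'.comap M''.subtype).mkQ ∘ₗ ρ
  have hh : Function.Surjective h := e.surjective.comp ((Submodule.mkQ_surjective _).comp hρ)
  have mem_ker (x : F'') : x ∈ LinearMap.ker h ↔ π x ∈ M' := by
    simp only [h, LinearEquiv.ker_comp, LinearMap.mem_ker, LinearMap.comp_apply,
      Submodule.mkQ_apply, Submodule.Quotient.mk_eq_zero]
    exact Iff.rfl
  obtain ⟨D, _, _, _, hfD, hhD⟩ := EmbedsWithPdLeOneCokernel.fibreProduct hf hh hP hF''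
  refine ⟨D, _, _, ‹_›, hfD, .trans ?_ hhD⟩
  have hi (x : LinearMap.ker π) : (x : F) ∈ F'' := (mem_F'' x).2 (by simp)
  have hi' (x : LinearMap.ker π) : π x ∈ M' := by simp
  refine .of_exact (C := M')
    (i := ((LinearMap.ker π).subtype.codRestrict F'' hi).codRestrict (LinearMap.ker h)
      fun x ↦ (mem_ker _).2 (hi' x))
    (q := (π ∘ₗ F''.subtype ∘ₗ (LinearMap.ker h).subtype).codRestrict M'
      fun x ↦ (mem_ker _).1 x.2) ?_ ?_ ?_ hM'
  · intro x y hxy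
    exact Subtype.ext (congrArg (fun s : LinearMap.ker h ↦ ((s : F'') : F)) hxy)
  · rintro ⟨m, hm⟩
    obtain ⟨x, rfl⟩ := hπ m
    exact ⟨⟨⟨x, (mem_F'' x).2 (hle hm)⟩, (mem_ker _).2 hm⟩, rfl⟩
  · rintro ⟨⟨x, hx⟩, hx'⟩
    constructor
    · intro h0
      exact ⟨⟨x, congrArg Subtype.val h0⟩, rfl⟩
    · rintro ⟨y, hy⟩
      rw [← hy]
      exact Subtype.ext y.2

theorem finite_of_forall_two_pow_mul_eq_intCast {Q : Type*} [CommRing Q] {n : ℕ} (hn : n ≠ 0)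
    (hQ : (n : Q) = 0) (h2 : IsUnit (2 : Q)) (h : ∀ q : Q, ∃ (k : ℕ) (z : ℤ), 2 ^ k * q = z) :
    Finite Q := by
  let φ := Int.castRingHom Q
  have hfin : Finite φ.range := by
    refine Finite.of_surjective (fun a : Fin n ↦ (⟨φ (a : ℕ), _, rfl⟩ : φ.range)) ?_
    rintro ⟨_, z, rfl⟩
    have hz := Int.emod_nonneg z (Int.natCast_ne_zero.2 hn)
    have hz' := Int.emod_lt_of_pos z (Int.natCast_pos.2 (Nat.pos_of_ne_zero hn))
    refine ⟨⟨(z % n).toNat, by omega⟩, Subtype.ext ?_⟩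
    change φ ((z % n).toNat : ℕ) = φ z
    rw [Int.toNat_of_nonneg hz]
    conv_rhs => rw [← Int.emod_add_mul_ediv z n]
    simp [φ, hQ]
  refine Finite.of_surjective (Subtype.val : φ.range → Q) fun q ↦ ⟨⟨q, ?_⟩, rfl⟩
  obtain ⟨k, z, hz⟩ := h q
  let m : φ.range → φ.range := fun x ↦ ⟨2 ^ k, 2 ^ k, by simp [φ]⟩ * x
  have hm : Function.Injective m := fun x y hxy ↦
    Subtype.ext ((h2.pow k).mul_left_cancel (congrArg Subtype.val hxy))
  obtain ⟨y, hy⟩ := Finite.surjective_of_injective hm ⟨z, z, rfl⟩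
  rw [← (h2.pow k).mul_left_cancel ((congrArg Subtype.val hy).trans hz.symm)]
  exact y.2

theorem finite_of_surjective_of_localizationAway_two {A Q : Type*} [CommRing A] [Algebra ℤ A]
    [IsLocalization.Away (2 : ℤ) A] [CommRing Q] {f : A →+* Q} (hf : Function.Surjective f)
    {n : ℕ} (hn : n ≠ 0) (hfn : f n = 0) : Finite Q := by
  refine finite_of_forall_two_pow_mul_eq_intCast hn (by rwa [← map_natCast f]) ?_ fun q ↦ ?_
  · simpa [map_ofNat f 2] using (IsLocalization.Away.algebraMap_isUnit (S := A) (2 : ℤ)).map f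
  · obtain ⟨a, rfl⟩ := hf q
    obtain ⟨k, z, hz⟩ := IsLocalization.Away.surj (2 : ℤ) a
    refine ⟨k, z, ?_⟩
    rw [mul_comm]
    simpa [map_ofNat f 2] using congrArg f hz

theorem finite_quotient_span_natCast_padicInt {p : ℕ} [Fact p.Prime] {n : ℕ} (hn : n ≠ 0) :
    Finite (ℤ_[p] ⧸ Ideal.span {(n : ℤ_[p])}) := by
  have hn' : (n : ℤ_[p]) ≠ 0 := Nat.cast_ne_zero.2 hn
  have hspan : Ideal.span {(n : ℤ_[p])} =
      RingHom.ker (PadicInt.toZModPow (p := p) (n : ℤ_[p]).valuation) := by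
    rw [PadicInt.ker_toZModPow]
    conv_lhs => rw [PadicInt.unitCoeff_spec hn']
    exact Ideal.span_singleton_mul_left_unit (Units.isUnit _) _
  have : NeZero (p ^ (n : ℤ_[p]).valuation) := ⟨pow_ne_zero _ (Fact.out : p.Prime).ne_zero⟩
  rw [hspan]
  exact Finite.of_injective _ (RingHom.kerLift_injective (PadicInt.toZModPow _))

theorem IsAllowedBase.charZero_isDomain {𝒪 : Type} [CommRing 𝒪] (h : IsAllowedBase 𝒪) :
    CharZero 𝒪 ∧ IsDomain 𝒪 := by
  have transfer {A : Type} [CommRing A] [CharZero A] [IsDomain A] (e : 𝒪 ≃+* A) :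
      CharZero 𝒪 ∧ IsDomain 𝒪 :=
    ⟨⟨fun a b hab ↦ by simpa using congrArg e hab⟩, MulEquiv.isDomain A e.toMulEquiv⟩
  obtain ⟨⟨e⟩⟩ | ⟨⟨e⟩⟩ | ⟨p, hp, ⟨e⟩⟩ := h
  · exact transfer e
  · have hle : Submonoid.powers (2 : ℤ) ≤ nonZeroDivisors ℤ :=
      powers_le_nonZeroDivisors_of_noZeroDivisors two_ne_zero
    have := IsLocalization.isDomain_localization hle
    have : CharZero (Localization.Away (2 : ℤ)) :=
      charZero_of_injective_algebraMap (IsLocalization.injective _ hle)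
    exact transfer e
  · have : Fact p.Prime := ⟨hp⟩
    exact transfer e

theorem IsAllowedBase.finite_quotient {𝒪 : Type} [CommRing 𝒪] (h : IsAllowedBase 𝒪) {n : ℕ}
    (hn : n ≠ 0) : Finite (𝒪 ⧸ Ideal.span {(n : 𝒪)}) := by
  have transfer {A : Type} [CommRing A] (e : 𝒪 ≃+* A)
      (hA : Finite (A ⧸ Ideal.span {(n : A)})) : Finite (𝒪 ⧸ Ideal.span {(n : 𝒪)}) :=
    Finite.of_equiv _ (Ideal.quotientEquiv (Ideal.span {(n : 𝒪)}) (Ideal.span {(n : A)}) e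
      (by simp [Ideal.map_span])).symm.toEquiv
  obtain ⟨⟨e⟩⟩ | ⟨⟨e⟩⟩ | ⟨p, hp, ⟨e⟩⟩ := h
  · exact transfer e (Ring.HasFiniteQuotients.finiteQuotient (by simpa using hn))
  · exact transfer e (finite_of_surjective_of_localizationAway_two
      Ideal.Quotient.mk_surjective hn
      (Ideal.Quotient.eq_zero_iff_mem.2 (Ideal.mem_span_singleton_self _)))
  · have : Fact p.Prime := ⟨hp⟩
    exact transfer e (finite_quotient_span_natCast_padicInt hn)

/-- Every finite `𝒪[Γ]`-module is a quotient of a finite module of projective dimension at most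
one, namely of a free module modulo the cardinality of the given one. -/
theorem IsAllowedBase.exists_finite_cover {𝒪 : Type} [CommRing 𝒪] (h𝒪 : IsAllowedBase 𝒪)
    (Γ : Type) [Group Γ] [Finite Γ] (M : Type) [AddCommGroup M]
    [Module (MonoidAlgebra 𝒪 Γ) M] [Finite M] :
    ∃ (F : Type) (_ : AddCommGroup F) (_ : Module (MonoidAlgebra 𝒪 Γ) F)
      (π : F →ₗ[MonoidAlgebra 𝒪 Γ] M),
      Finite F ∧ PdLeOne (MonoidAlgebra 𝒪 Γ) F ∧ Function.Surjective π := by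
  let R := MonoidAlgebra 𝒪 Γ
  let G := M →₀ R
  let n := Nat.card M
  have hn : n ≠ 0 := Nat.card_pos.ne'
  obtain ⟨_, _⟩ := h𝒪.charZero_isDomain
  have _ := h𝒪.finite_quotient hn
  let ν : G →ₗ[R] G := n • LinearMap.id
  have hν (g : G) (m : M) (γ : Γ) : (ν g m).coeff γ = n * (g m).coeff γ := by
    change ((n • g) m).coeff γ = _
    rw [Finsupp.smul_apply, MonoidAlgebra.coeff_smul, Finsupp.smul_apply, nsmul_eq_mul]
  have hinj : Function.Injective ν := by
    intro a b hab
    ext m γ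
    have := congrArg (fun g : G ↦ (g m).coeff γ) hab
    simp only [hν] at this
    exact mul_left_cancel₀ (Nat.cast_ne_zero.2 hn) this
  refine ⟨G ⧸ LinearMap.range ν, inferInstance, inferInstance,
    (LinearMap.range ν).liftQ (Finsupp.linearCombination R id) ?_, ?_, ?_, ?_⟩
  · rintro _ ⟨g, rfl⟩
    change Finsupp.linearCombination R id (n • g) = 0
    rw [map_nsmul]
    exact card_nsmul_eq_zero'
  · let Φ : G → M → Γ → 𝒪 ⧸ Ideal.span {(n : 𝒪)} := fun g m γ ↦
      Ideal.Quotient.mk _ ((g m).coeff γ)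
    refine Finite.of_injective (fun x : G ⧸ LinearMap.range ν ↦ Φ x.out) fun x y hxy ↦ ?_
    rw [← x.out_eq, ← y.out_eq]
    refine (Submodule.Quotient.eq _).2 ?_
    have hdvd (m : M) (γ : Γ) : ∃ c, (x.out m).coeff γ - (y.out m).coeff γ = n * c :=
      Ideal.mem_span_singleton.1 (Ideal.Quotient.eq.1 (congrFun (congrFun hxy m) γ))
    choose c hc using hdvd
    refine ⟨Finsupp.equivFunOnFinite.symm fun m ↦
      .ofCoeff (Finsupp.equivFunOnFinite.symm (c m)), ?_⟩
    ext m γ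
    rw [hν]
    exact (hc m γ).symm
  · refine ⟨G, inferInstance, inferInstance, (LinearMap.range ν).mkQ,
      Submodule.mkQ_surjective _, inferInstance, ?_⟩
    rw [Submodule.ker_mkQ]
    exact Module.Projective.of_equiv (LinearEquiv.ofInjective ν hinj)
  · intro m
    obtain ⟨g, hg⟩ := Finsupp.linearCombination_id_surjective R M m
    exact ⟨Submodule.mkQ _ g, hg⟩

/-- Well-definedness of the first syzygy operator `ω¹`: if `X ∼ Y` are finite
modules over `R = 𝒪[Γ₀]` and `P → X`, `Q → Y` are surjections from finite modules
of projective dimension at most one, then `ker(P → X) ∼ ker(Q → Y)`. -/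
theorem omega1_well_defined
    (𝒪 : Type) [CommRing 𝒪] (h𝒪 : IsAllowedBase 𝒪)
    (Γ₀ : Type) [Group Γ₀] [Finite Γ₀]
    (X : Type) [AddCommGroup X] [Module (MonoidAlgebra 𝒪 Γ₀) X] [Finite X]
    (Y : Type) [AddCommGroup Y] [Module (MonoidAlgebra 𝒪 Γ₀) Y] [Finite Y]
    (hXY : ModEquiv (MonoidAlgebra 𝒪 Γ₀) X Y)
    (P : Type) [AddCommGroup P] [Module (MonoidAlgebra 𝒪 Γ₀) P] [Finite P]
    (Q : Type) [AddCommGroup Q] [Module (MonoidAlgebra 𝒪 Γ₀) Q] [Finite Q]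
    (hP : PdLeOne (MonoidAlgebra 𝒪 Γ₀) P)
    (hQ : PdLeOne (MonoidAlgebra 𝒪 Γ₀) Q)
    (f : P →ₗ[MonoidAlgebra 𝒪 Γ₀] X) (g : Q →ₗ[MonoidAlgebra 𝒪 Γ₀] Y)
    (hf : Function.Surjective f) (hg : Function.Surjective g) :
    ModEquiv (MonoidAlgebra 𝒪 Γ₀) (LinearMap.ker f) (LinearMap.ker g) := by
  obtain ⟨M, _, _, N, _, _, _, _, ⟨e⟩, M', M'', N', N'', hM, hN, hM', hN', hM'', hN'',
    ⟨eX⟩, ⟨eY⟩⟩ := hXY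
  obtain ⟨F, _, _, π, _, hF, hπ⟩ := h𝒪.exists_finite_cover Γ₀ M
  obtain ⟨B, _, _, _, hfB, hB⟩ :=
    EmbedsWithPdLeOneCokernel.of_subquotient hM hM' hM'' eX hπ hF hf hP
  obtain ⟨C, _, _, _, hgC, hC⟩ := EmbedsWithPdLeOneCokernel.of_subquotient hN hN' hN'' eY
    (π := e.toLinearMap ∘ₗ π) (e.surjective.comp hπ) hF hg hQ
  rw [LinearEquiv.ker_comp] at hC
  obtain ⟨D, _, _, _, hBD, hCD⟩ := hB.amalgamate hC
  exact .of_embeds (hfB.trans hBD) (hgC.trans hCD)
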